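/- Assume π_0 = 0 and, for every n ≥ 1, π_n ≠ 0 and f(π_n) = π_{n−1}. Then for all integers n > m ≥ 1, the field extension ℚ_p(π_n)/ℚ_p(π_m) has degree p^{n−m}, and the field trace satisfies Tr_{ℚ_p(π_n)/ℚ_p(π_m)}(π_n) = −p^{n−m−1}·α_{p−1}. -/

import Mathlib

open Polynomial
open scoped Classical

set_option synthInstance.maxHeartbeats 1000000
set_option maxHeartbeats 1000000

/-- The relative degree `[E : F]` of intermediate fields `F ≤ E` of `K/ℚ_p`
(junk value `0` if `F ≰ E`). -/
noncomputable def relDegree {p : ℕ} [Fact p.Prime] {K : Type} [Field K] [Algebra ℚ_[p] K]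
    (F E : IntermediateField ℚ_[p] K) : ℕ :=
  if h : F ≤ E then
    letI : Algebra F E := ((IntermediateField.inclusion h).toRingHom).toAlgebra
    Module.finrank F E
  else 0

/-- The relative field trace `Tr_{E/F}` for intermediate fields `F ≤ E` of `K/ℚ_p`,
viewed as taking values in `K` (junk value `0` if `F ≰ E` or the element is not in `E`). -/
noncomputable def relTrace {p : ℕ} [Fact p.Prime] {K : Type} [Field K] [Algebra ℚ_[p] K]
    (F E : IntermediateField ℚ_[p] K) (x : K) : K :=
  if h : F ≤ E ∧ x ∈ E then
    letI : Algebra F E := ((IntermediateField.inclusion h.1).toRingHom).toAlgebra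
    ((Algebra.trace F E ⟨x, h.2⟩ : F) : K)
  else 0

/-- If `x` generates `L` over `k` and is a root of a monic polynomial over `E` of degree `[L : E]`
whose second coefficient `a` lies in `k`, then `Tr_{L/F}(x) = -[E : F] a`. -/
theorem trace_eq_of_monic_root {k F E L : Type*} [Field k] [Field F] [Field E] [Field L]
    [Algebra k F] [Algebra k E] [Algebra k L] [Algebra F E] [Algebra F L] [Algebra E L]
    [IsScalarTower k F E] [IsScalarTower k E L] [IsScalarTower F E L]
    [FiniteDimensional F E] [FiniteDimensional E L]
    (x : L) (hx : IntermediateField.adjoin k {x} = ⊤) (g : E[X]) (hg : g.Monic)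
    (hdeg : g.natDegree = Module.finrank E L) (hroot : aeval x g = 0) (a : k)
    (ha : g.nextCoeff = algebraMap k E a) :
    Algebra.trace F L x = algebraMap k F (-(Module.finrank F E : k) * a) := by
  have htop : IntermediateField.adjoin E {x} = ⊤ :=
    IntermediateField.adjoin_eq_top_of_adjoin_eq_top k hx
  have hmin : minpoly E x = g := by
    refine (eq_of_monic_of_dvd_of_natDegree_le (minpoly.monic (.of_finite E x)) hg
      (minpoly.dvd E x hroot) ?_).symm
    rw [hdeg, (Field.primitive_element_iff_minpoly_natDegree_eq E x).1 htop]
  have htr : Algebra.trace E L x = algebraMap F E (algebraMap k F (-a)) := by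
    rw [trace_eq_finrank_mul_minpoly_nextCoeff, hmin, ha, htop,
      IntermediateField.finrank_top, ← IsScalarTower.algebraMap_apply]
    simp
  rw [← Algebra.trace_trace (S := E), htr, Algebra.trace_algebraMap]
  simp

section IntermediateFields

variable {p : ℕ} [Fact p.Prime] {K : Type} [Field K] [Algebra ℚ_[p] K]

theorem finrank_mul_relDegree {F E : IntermediateField ℚ_[p] K} (h : F ≤ E) :
    Module.finrank ℚ_[p] F * relDegree F E = Module.finrank ℚ_[p] E := by
  rw [relDegree, dif_pos h]
  let : Algebra F E := ((IntermediateField.inclusion h).toRingHom).toAlgebra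
  have : IsScalarTower ℚ_[p] F E := IsScalarTower.of_algebraMap_eq fun _ => rfl
  exact Module.finrank_mul_finrank ℚ_[p] F E

theorem relTrace_eq_of_monic_root {F E : IntermediateField ℚ_[p] K} (x : K) (hFE : F ≤ E)
    (hEL : E ≤ IntermediateField.adjoin ℚ_[p] {x})
    [FiniteDimensional ℚ_[p] (IntermediateField.adjoin ℚ_[p] {x})]
    (g : E[X]) (hg : g.Monic)
    (hdeg : g.natDegree = relDegree E (IntermediateField.adjoin ℚ_[p] {x}))
    (hroot : aeval x g = 0) (a : ℚ_[p]) (ha : g.nextCoeff = algebraMap ℚ_[p] E a) :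
    relTrace F (IntermediateField.adjoin ℚ_[p] {x}) x
      = algebraMap ℚ_[p] K (-(relDegree F E : ℚ_[p]) * a) := by
  have hxL := IntermediateField.mem_adjoin_simple_self ℚ_[p] x
  rw [relDegree, dif_pos hEL] at hdeg
  rw [relDegree, dif_pos hFE, relTrace, dif_pos ⟨hFE.trans hEL, hxL⟩]
  set L := IntermediateField.adjoin ℚ_[p] {x} with hL
  let : Algebra F E := ((IntermediateField.inclusion hFE).toRingHom).toAlgebra
  let : Algebra E L := ((IntermediateField.inclusion hEL).toRingHom).toAlgebra
  let : Algebra F L := ((IntermediateField.inclusion (hFE.trans hEL)).toRingHom).toAlgebra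
  have : IsScalarTower ℚ_[p] F E := IsScalarTower.of_algebraMap_eq fun _ => rfl
  have : IsScalarTower ℚ_[p] E L := IsScalarTower.of_algebraMap_eq fun _ => rfl
  have : IsScalarTower F E L := IsScalarTower.of_algebraMap_eq fun _ => rfl
  have : IsScalarTower E L K := IsScalarTower.of_algebraMap_eq fun _ => rfl
  have : FiniteDimensional E L := FiniteDimensional.right ℚ_[p] E L
  have : FiniteDimensional ℚ_[p] E := FiniteDimensional.left ℚ_[p] E L
  have : FiniteDimensional F E := FiniteDimensional.right ℚ_[p] F E
  have htop : IntermediateField.adjoin ℚ_[p] {(⟨x, hxL⟩ : L)} = ⊤ := by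
    apply IntermediateField.map_injective L.val
    rw [IntermediateField.adjoin_map, ← AlgHom.fieldRange_eq_map,
      IntermediateField.fieldRange_val]
    simp [hL]
  have hroot' : aeval (⟨x, hxL⟩ : L) g = 0 := by
    apply (algebraMap L K).injective
    rw [← aeval_algebraMap_apply, map_zero]
    exact hroot
  exact congrArg (algebraMap F K)
    (trace_eq_of_monic_root (k := ℚ_[p]) (F := F) (⟨x, hxL⟩ : L) htop g hg hdeg hroot' a ha)

end IntermediateFields

/-- A monic polynomial that reduces to a power of `X` modulo a prime ideal `P`, with constant term
outside `P ^ 2`, is Eisenstein at `P`. -/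
theorem isEisensteinAt_of_map_eq_X_pow {R : Type*} [CommRing R] {P : Ideal R} [P.IsPrime]
    {g : R[X]} (hg : g.Monic) {k : ℕ} (hmap : g.map (Ideal.Quotient.mk P) = X ^ k)
    (h0 : g.coeff 0 ∉ P ^ 2) : g.IsEisensteinAt P := by
  have hk : g.natDegree = k := by
    rw [← hg.natDegree_map (Ideal.Quotient.mk P), hmap, natDegree_X_pow]
  refine ⟨?_, fun {n} hn => ?_, h0⟩
  · rw [hg.leadingCoeff]
    exact (Ideal.ne_top_iff_one P).1 (Ideal.IsPrime.ne_top ‹_›)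
  · rw [← Ideal.Quotient.eq_zero_iff_mem, ← coeff_map, hmap, coeff_X_pow, if_neg (by omega)]

/-- The composite `h ∘ F ∘ ⋯ ∘ F`, with `n` factors `F`. -/
noncomputable def compIterate {R : Type*} [CommRing R] (h F : R[X]) (n : ℕ) : R[X] :=
  (fun g : R[X] => g.comp F)^[n] h

section CompIterate

variable {R : Type*} [CommRing R] (h F : R[X])

theorem compIterate_succ (n : ℕ) : compIterate h F (n + 1) = (compIterate h F n).comp F :=
  Function.iterate_succ_apply' _ n h

theorem map_compIterate {S : Type*} [CommRing S] (φ : R →+* S) (n : ℕ) :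
    (compIterate h F n).map φ = compIterate (h.map φ) (F.map φ) n := by
  induction n with
  | zero => rfl
  | succ n ih => rw [compIterate_succ, compIterate_succ, Polynomial.map_comp, ih]

theorem compIterate_X_pow (a b n : ℕ) :
    compIterate (X ^ a : R[X]) (X ^ b) n = X ^ (a * b ^ n) := by
  induction n with
  | zero => simp [compIterate]
  | succ n ih => rw [compIterate_succ, ih, X_pow_comp, ← pow_mul, pow_succ]; ring_nf

variable {h F}

theorem monic_compIterate (hh : h.Monic) (hF : F.Monic) (hF0 : F.natDegree ≠ 0) (n : ℕ) :
    (compIterate h F n).Monic := by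
  induction n with
  | zero => exact hh
  | succ n ih => rw [compIterate_succ]; exact ih.comp hF hF0

theorem coeff_zero_compIterate (hF : F.coeff 0 = 0) (n : ℕ) :
    (compIterate h F n).coeff 0 = h.coeff 0 := by
  induction n with
  | zero => rfl
  | succ n ih =>
    rw [compIterate_succ, coeff_zero_eq_eval_zero, eval_comp, ← coeff_zero_eq_eval_zero F, hF,
      ← coeff_zero_eq_eval_zero, ih]

theorem aeval_compIterate {A : Type*} [CommRing A] [Algebra R A] (π : ℕ → A)
    (hπ : ∀ n, aeval (π (n + 1)) F = π n) (h1 : aeval (π 1) h = 0) (n : ℕ) :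
    aeval (π (n + 1)) (compIterate h F n) = 0 := by
  induction n with
  | zero => exact h1
  | succ n ih => rw [compIterate_succ, aeval_comp, hπ, ih]

/-- If `h` and `F` are monic and reduce to `X ^ a`, `X ^ b` modulo a prime `P`, `F(0) = 0` and
`h(0) ∉ P ^ 2`, then all the composites `h ∘ F ∘ ⋯ ∘ F` are irreducible. -/
theorem irreducible_compIterate [IsDomain R] {P : Ideal R} [P.IsPrime] (hh : h.Monic)
    (hF : F.Monic) {a b : ℕ} (ha : a ≠ 0) (hb : b ≠ 0)
    (hhm : h.map (Ideal.Quotient.mk P) = X ^ a) (hFm : F.map (Ideal.Quotient.mk P) = X ^ b)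
    (hF0 : F.coeff 0 = 0) (hh0 : h.coeff 0 ∉ P ^ 2) (n : ℕ) :
    Irreducible (compIterate h F n) ∧ (compIterate h F n).natDegree = a * b ^ n := by
  have hFd : F.natDegree = b := by
    rw [← hF.natDegree_map (Ideal.Quotient.mk P), hFm, natDegree_X_pow]
  have hmon := monic_compIterate hh hF (hFd ▸ hb) n
  have hmap : (compIterate h F n).map (Ideal.Quotient.mk P) = X ^ (a * b ^ n) := by
    rw [map_compIterate, hhm, hFm, compIterate_X_pow]
  have hdeg : (compIterate h F n).natDegree = a * b ^ n := by
    rw [← hmon.natDegree_map (Ideal.Quotient.mk P), hmap, natDegree_X_pow]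
  refine ⟨(isEisensteinAt_of_map_eq_X_pow hmon hmap ?_).irreducible ‹_› hmon.isPrimitive ?_, hdeg⟩
  · rwa [coeff_zero_compIterate hF0]
  · rw [hdeg]; positivity

end CompIterate

/-- In the tower attached to `f`, the extension `ℚ_p(π_{n+1})/ℚ_p` has degree `(p-1)p^n`. -/
theorem finrank_adjoin_tower {p : ℕ} [Fact p.Prime] {K : Type*} [Field K] [Algebra ℚ_[p] K]
    (α : ℕ → ℚ_[p]) (hα : ∀ i, 1 ≤ i → i ≤ p - 1 → ‖α i‖ ≤ (p : ℝ)⁻¹)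
    (hα1 : ‖α 1‖ = (p : ℝ)⁻¹) (f : ℚ_[p][X])
    (hf : f = X ^ p + ∑ i ∈ Finset.Icc 1 (p - 1), C (α i) * X ^ i)
    (π : ℕ → K) (hπ0 : π 0 = 0) (hπ : ∀ n : ℕ, aeval (π (n + 1)) f = π n)
    (hπ1 : π 1 ≠ 0) (n : ℕ) :
    IsIntegral ℚ_[p] (π (n + 1)) ∧
      Module.finrank ℚ_[p] (IntermediateField.adjoin ℚ_[p] {π (n + 1)}) = (p - 1) * p ^ n := by
  have hp : p.Prime := Fact.out
  have hp2 := hp.two_le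
  have hp1 : (p : ℝ)⁻¹ ≤ 1 := inv_le_one_of_one_le₀ (by exact_mod_cast hp.one_le)
  have hlift : ∀ i, ∃ b : ℤ_[p], i ∈ Finset.Icc 1 (p - 1) → algebraMap ℤ_[p] ℚ_[p] b = α i := by
    intro i
    by_cases hi : ‖α i‖ ≤ 1
    · exact ⟨⟨α i, hi⟩, fun _ => rfl⟩
    · refine ⟨0, fun h => absurd ?_ hi⟩
      rw [Finset.mem_Icc] at h
      exact (hα i h.1 h.2).trans hp1
  choose a ha using hlift
  have hmem1 : 1 ∈ Finset.Icc 1 (p - 1) := by rw [Finset.mem_Icc]; omega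
  let P : Ideal ℤ_[p] := Ideal.span {(p : ℤ_[p])}
  have : P.IsPrime :=
    (Ideal.span_singleton_prime PadicInt.prime_p.ne_zero).2 PadicInt.prime_p
  have hnorm : ∀ i ∈ Finset.Icc 1 (p - 1), ‖a i‖ = ‖α i‖ := fun i hi => by rw [← ha i hi]; rfl
  have haP : ∀ i ∈ Finset.Icc 1 (p - 1), Ideal.Quotient.mk P (a i) = 0 := by
    intro i hi
    have := (PadicInt.norm_le_pow_iff_mem_span_pow (a i) 1).1
    rw [pow_one] at this
    refine Ideal.Quotient.eq_zero_iff_mem.2 (this ?_)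
    rw [hnorm i hi]
    rw [Finset.mem_Icc] at hi
    simpa using hα i hi.1 hi.2
  have ha1 : a 1 ∉ P ^ 2 := by
    rw [Ideal.span_singleton_pow, ← PadicInt.norm_le_pow_iff_mem_span_pow, hnorm 1 hmem1, hα1,
      not_le, ← zpow_neg_one]
    exact zpow_lt_zpow_right₀ (by exact_mod_cast hp.one_lt) (by norm_num)
  let S : ℤ_[p][X] := ∑ i ∈ Finset.Icc 1 (p - 1), C (a i) * X ^ (i - 1)
  have hSmap : S.map (Ideal.Quotient.mk P) = 0 := by
    simp only [S, Polynomial.map_sum]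
    exact Finset.sum_eq_zero fun i hi => by simp [haP i hi]
  have hSdeg : S.degree < ((p - 1 : ℕ) : WithBot ℕ) := by
    refine (degree_sum_le _ _).trans_lt ((Finset.sup_lt_iff (WithBot.bot_lt_coe _)).2 ?_)
    intro i hi
    rw [Finset.mem_Icc] at hi
    exact (degree_C_mul_X_pow_le _ _).trans_lt (by exact_mod_cast (by omega : i - 1 < p - 1))
  have hS0 : S.coeff 0 = a 1 := by
    simp only [S, finsetSum_coeff, coeff_C_mul, coeff_X_pow]
    rw [Finset.sum_eq_single_of_mem 1 hmem1]
    · simp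
    · intro i hi hne
      rw [Finset.mem_Icc] at hi
      rw [if_neg (by omega), mul_zero]
  let H : ℤ_[p][X] := X ^ (p - 1) + S
  have hH : H.Monic := monic_X_pow_add hSdeg
  have hfmap : (X * H).map (algebraMap ℤ_[p] ℚ_[p]) = f := by
    simp only [H, S, hf, mul_add, Finset.mul_sum, Polynomial.map_add, Polynomial.map_sum,
      Polynomial.map_mul, Polynomial.map_pow, map_X, map_C]
    rw [← pow_succ', Nat.sub_add_cancel hp.one_le]
    congr 1
    refine Finset.sum_congr rfl fun i hi => ?_
    rw [ha i hi, mul_left_comm, ← pow_succ']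
    rw [Finset.mem_Icc] at hi
    rw [Nat.sub_add_cancel hi.1]
  have hHm : H.map (Ideal.Quotient.mk P) = X ^ (p - 1) := by simp [H, hSmap]
  obtain ⟨hirr, hdeg⟩ := irreducible_compIterate (P := P) hH (monic_X.mul hH)
    (a := p - 1) (b := p) (by omega) hp.ne_zero hHm
    (by rw [Polynomial.map_mul, hHm, map_X, ← pow_succ', Nat.sub_add_cancel hp.one_le])
    (by simp) (by
      have : H.coeff 0 = a 1 := by
        rw [coeff_add, hS0, coeff_X_pow, if_neg (by omega), zero_add]
      rwa [this]) n
  have hmon : (compIterate H (X * H) n).Monic := by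
    refine monic_compIterate hH (monic_X.mul hH) ?_ n
    rw [monic_X.natDegree_mul hH, natDegree_X]
    omega
  have hroot : aeval (π (n + 1)) ((compIterate H (X * H) n).map (algebraMap ℤ_[p] ℚ_[p])) = 0 := by
    rw [map_compIterate, hfmap]
    refine aeval_compIterate π hπ ?_ n
    have h0 := hπ 0
    rw [← hfmap, Polynomial.map_mul, map_X, map_mul, aeval_X, hπ0] at h0
    exact (mul_eq_zero.1 h0).resolve_left hπ1
  have hπint : IsIntegral ℚ_[p] (π (n + 1)) := ⟨_, hmon.map _, hroot⟩
  refine ⟨hπint, ?_⟩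
  rw [IntermediateField.adjoin.finrank hπint, ← minpoly.eq_of_irreducible_of_monic
    ((hmon.irreducible_iff_irreducible_map_fraction_map (K := ℚ_[p])).1 hirr) hroot (hmon.map _),
    hmon.natDegree_map, hdeg]

/-- For `n > m ≥ 1`, the extension `ℚ_p(π_n)/ℚ_p(π_m)` has degree `p^{n−m}`
and `Tr_{ℚ_p(π_n)/ℚ_p(π_m)}(π_n) = −p^{n−m−1}·α_{p−1}`. -/
theorem degree_and_trace_in_tower
    {p : ℕ} [Fact p.Prime]
    -- `K` is a fixed algebraic closure of `ℚ_p` with the unique extension of the p-adic norm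
    {K : Type} [NormedField K] [Algebra ℚ_[p] K] [IsAlgClosure ℚ_[p] K]
    (hnorm : ∀ x : ℚ_[p], ‖algebraMap ℚ_[p] K x‖ = ‖x‖)
    -- the polynomial f(X) = X^p + α_{p-1} X^{p-1} + ⋯ + α_1 X, with α_i ∈ pℤ_p, v_p(α_1) = 1
    (α : ℕ → ℚ_[p])
    (hα : ∀ i, 1 ≤ i → i ≤ p - 1 → ‖α i‖ ≤ (p : ℝ)⁻¹)
    (hα1 : ‖α 1‖ = (p : ℝ)⁻¹)
    (f : ℚ_[p][X])
    (hf : f = X ^ p + ∑ i ∈ Finset.Icc 1 (p - 1), C (α i) * X ^ i)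
    -- the tower π_0 = 0, f(π_n) = π_{n−1}, π_n ≠ 0 for n ≥ 1
    (π : ℕ → K) (hπ0 : π 0 = 0)
    (hπ : ∀ n : ℕ, Polynomial.aeval (π (n + 1)) f = π n)
    (hπne : ∀ n : ℕ, π (n + 1) ≠ 0) :
    ∀ m n : ℕ, 1 ≤ m → m < n →
      IntermediateField.adjoin ℚ_[p] {π m} ≤ IntermediateField.adjoin ℚ_[p] {π n} ∧
      relDegree (IntermediateField.adjoin ℚ_[p] {π m}) (IntermediateField.adjoin ℚ_[p] {π n})
        = p ^ (n - m) ∧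
      relTrace (IntermediateField.adjoin ℚ_[p] {π m}) (IntermediateField.adjoin ℚ_[p] {π n})
        (π n) = algebraMap ℚ_[p] K (-(p : ℚ_[p]) ^ (n - m - 1) * α (p - 1)) := by
  have hp : p.Prime := Fact.out
  have hp2 := hp.two_le
  have hfin := finrank_adjoin_tower α hα hα1 f hf π hπ0 hπ (hπne 0)
  have hstep : ∀ n, IntermediateField.adjoin ℚ_[p] {π n} ≤
      IntermediateField.adjoin ℚ_[p] {π (n + 1)} := by
    intro n
    rw [IntermediateField.adjoin_simple_le_iff, ← hπ n]
    exact IntermediateField.algebra_adjoin_le_adjoin ℚ_[p] _ (aeval_mem_adjoin_singleton ℚ_[p] _)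
  have hmono : Monotone fun n => IntermediateField.adjoin ℚ_[p] {π n} :=
    monotone_nat_of_le_succ hstep
  have hrel : ∀ m n : ℕ, 1 ≤ m → m ≤ n →
      relDegree (IntermediateField.adjoin ℚ_[p] {π m}) (IntermediateField.adjoin ℚ_[p] {π n})
        = p ^ (n - m) := by
    intro m n hm hmn
    obtain ⟨m, rfl⟩ := Nat.exists_eq_add_of_le' hm
    obtain ⟨d, rfl⟩ := Nat.exists_eq_add_of_le hmn
    have h := finrank_mul_relDegree (hmono hmn)
    simp only at h
    rw [(hfin m).2, show m + 1 + d = m + d + 1 by ring, (hfin (m + d)).2, pow_add,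
      ← mul_assoc] at h
    rw [show m + 1 + d = m + d + 1 by ring, show m + d + 1 - (m + 1) = d by omega]
    exact Nat.eq_of_mul_eq_mul_left (Nat.mul_pos (by omega) (pow_pos hp.pos m)) h
  intro m n hm hmn
  refine ⟨hmono hmn.le, hrel m n hm hmn.le, ?_⟩
  obtain ⟨n, rfl⟩ := Nat.exists_eq_add_of_le' (hm.trans hmn.le)
  have hmn' : m ≤ n := by omega
  have := IntermediateField.adjoin.finiteDimensional (hfin n).1
  set E := IntermediateField.adjoin ℚ_[p] {π n} with hE
  have hSdeg : (∑ i ∈ Finset.Icc 1 (p - 1), C (α i) * X ^ i).degree < ((p : ℕ) : WithBot ℕ) := by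
    refine (degree_sum_le _ _).trans_lt ((Finset.sup_lt_iff (WithBot.bot_lt_coe _)).2 ?_)
    intro i hi
    rw [Finset.mem_Icc] at hi
    exact (degree_C_mul_X_pow_le _ _).trans_lt (by exact_mod_cast (by omega : i < p))
  have hfmon : f.Monic := hf ▸ monic_X_pow_add hSdeg
  have hfdeg : f.natDegree = p := by
    rw [hf, natDegree_eq_of_degree_eq (degree_add_eq_left_of_degree_lt (by rwa [degree_X_pow])),
      natDegree_X_pow]
  have hfcoeff : f.coeff (p - 1) = α (p - 1) := by
    rw [hf, coeff_add, coeff_X_pow, if_neg (by omega), zero_add]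
    simp only [finsetSum_coeff, coeff_C_mul, coeff_X_pow]
    rw [Finset.sum_eq_single_of_mem (p - 1) (by rw [Finset.mem_Icc]; omega)]
    · simp
    · intro i _ hne
      rw [if_neg (Ne.symm hne), mul_zero]
  let y : E := ⟨π n, IntermediateField.mem_adjoin_simple_self ℚ_[p] (π n)⟩
  let g : E[X] := f.map (algebraMap ℚ_[p] E) - C y
  have hfE : (f.map (algebraMap ℚ_[p] E)).natDegree = p := by rw [hfmon.natDegree_map, hfdeg]
  have hgdeg : g.natDegree = p := by rw [natDegree_sub_C, hfE]
  have hg : g.Monic := by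
    refine (hfmon.map _).sub_of_left (degree_C_le.trans_lt ?_)
    rw [← natDegree_pos_iff_degree_pos, hfE]
    exact hp.pos
  have h := relTrace_eq_of_monic_root (F := IntermediateField.adjoin ℚ_[p] {π m}) (E := E)
    (π (n + 1)) (hmono hmn') (hstep n) g hg
    (by rw [hgdeg, hrel n (n + 1) (hm.trans hmn') n.le_succ]; simp)
    (by
      rw [map_sub, aeval_map_algebraMap, hπ, aeval_C, sub_eq_zero]
      rfl)
    (α (p - 1)) (by
      rw [nextCoeff_of_natDegree_pos (by rw [hgdeg]; exact hp.pos), hgdeg, coeff_sub,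
        coeff_map, hfcoeff, coeff_C, if_neg (by omega), sub_zero])
  rw [h, hrel m n hm hmn', show n + 1 - m - 1 = n - m by omega, Nat.cast_pow]
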